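/- Let γ ∈ (1/2, 1), let m ≥ 2 and 1 ≤ k ≤ m−1 be integers, and let x ∈ (0,1). Then ∫_x^1 dt_0 ∫_x^{t_0} dt_1 ⋯ ∫_x^{t_{k−1}} dt_k [ t_0^(γ−1) · (∏_{j=1}^{k−1} t_j^(−1)) · t_k^(−γ) · ∫_{t_k}^1 dt_{k+1} ⋯ ∫_{t_{m−1}}^1 dt_m ( t_k^(−γ) · (∏_{j=k+1}^{m−1} t_j^(−1)) · t_m^(γ−1) ) ] ≤ C(m−2, k−1) · x^(1−2γ) · (log(1/x))^(m−2) / (γ² · (2γ−1) · (m−2)!), where C(m−2, k−1) denotes the binomial coefficient (m−2 choose k−1). -/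

import Mathlib

open MeasureTheory

section Valley

open Set

/-- The points of `ℝ ^ (n + 1)` whose coordinates decrease up to the index `k` and increase
afterwards. -/
def valley (n k : ℕ) : Set (Fin (n + 1) → ℝ) :=
  {t | ∀ i : Fin n, ((i : ℕ) < k → t i.succ < t i.castSucc) ∧
    (k ≤ (i : ℕ) → t i.castSucc < t i.succ)}

/-- The integral of `∏ j, φ j (t j)` over the points `t` of `valley n k`. -/
noncomputable def valleyIntegral (n k : ℕ) (φ : ℕ → ℝ → ENNReal) : ENNReal :=
  ∫⁻ t in valley n k, ∏ j : Fin (n + 1), φ j (t j)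

theorem measurableSet_valley (n k : ℕ) : MeasurableSet (valley n k) := by
  simp only [valley, ofPred_forall, ofPred_and]
  refine MeasurableSet.iInter fun i => .inter (.iInter fun _ => ?_) (.iInter fun _ => ?_) <;>
  exact measurableSet_lt (measurable_pi_apply _) (measurable_pi_apply _)

theorem cons_mem_valley {n k : ℕ} {u : ℝ} {y : Fin (n + 1) → ℝ} :
    (Fin.cons u y : Fin (n + 1 + 1) → ℝ) ∈ valley (n + 1) (k + 1) ↔
      y 0 < u ∧ y ∈ valley n k := by
  simp [valley, Fin.forall_fin_succ (n := n)]

theorem rev_mem_valley {n : ℕ} {t : Fin (n + 1) → ℝ} (ht : t ∘ Fin.rev ∈ valley n 0) :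
    t ∈ valley n n := by
  intro i
  refine ⟨fun _ => ?_, fun h => absurd i.2 (by omega)⟩
  have h := (ht i.rev).2 (Nat.zero_le _)
  simpa [Fin.rev_castSucc, Fin.rev_succ] using h

theorem lintegral_fin_succ_le (n : ℕ) (f : (Fin (n + 1) → ℝ) → ENNReal) :
    ∫⁻ t, f t ≤ ∫⁻ y : Fin n → ℝ, ∫⁻ u : ℝ, f (Fin.cons u y) := by
  have h := (volume_preserving_piFinSuccAbove (fun _ : Fin (n + 1) => ℝ) 0).symm
  rw [← h.lintegral_comp_emb (MeasurableEquiv.measurableEmbedding _)]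
  rw [Measure.volume_eq_prod, ← lintegral_prod_swap]
  refine (lintegral_prod_le _).trans (le_of_eq ?_)
  simp [MeasurableEquiv.piFinSuccAbove, Fin.insertNthEquiv]

theorem valleyIntegral_zero (φ : ℕ → ℝ → ENNReal) : valleyIntegral 0 0 φ = ∫⁻ s, φ 0 s := by
  have h := (volume_preserving_funUnique (Fin 1) ℝ).symm
  have hv : valley 0 0 = univ := eq_univ_of_forall fun t i => i.elim0
  rw [valleyIntegral, hv, Measure.restrict_univ]
  refine (h.lintegral_comp_emb (MeasurableEquiv.measurableEmbedding _) _).symm.trans ?_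
  simp

theorem valleyIntegral_mono {n k : ℕ} {φ ψ : ℕ → ℝ → ENNReal} (h : ∀ j s, φ j s ≤ ψ j s) :
    valleyIntegral n k φ ≤ valleyIntegral n k ψ :=
  lintegral_mono fun t => Finset.prod_le_prod' fun j _ => h j (t j)

theorem valleyIntegral_succ_le (n k : ℕ) (φ : ℕ → ℝ → ENNReal)
    (hφ : ∀ j s, φ (j + 1) s ≠ ⊤) :
    valleyIntegral (n + 1) (k + 1) φ ≤ valleyIntegral n k
      (fun j s => if j = 0 then φ 1 s * ∫⁻ u in Ioi s, φ 0 u else φ (j + 1) s) := by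
  unfold valleyIntegral
  rw [← lintegral_indicator (measurableSet_valley _ _),
    ← lintegral_indicator (measurableSet_valley _ _)]
  refine (lintegral_fin_succ_le _ _).trans (lintegral_mono fun y => ?_)
  by_cases hy : y ∈ valley n k
  · have heq : ∀ u, (valley (n + 1) (k + 1)).indicator
          (fun t => ∏ j : Fin (n + 1 + 1), φ j (t j)) (Fin.cons u y) =
        (∏ j : Fin (n + 1), φ (j + 1) (y j)) * (Ioi (y 0)).indicator (φ 0) u := by
      intro u
      by_cases hu : y 0 < u
      · rw [indicator_of_mem (cons_mem_valley.2 ⟨hu, hy⟩), indicator_of_mem (mem_Ioi.2 hu),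
          Fin.prod_univ_succ, mul_comm]
        simp
      · rw [indicator_of_notMem fun h => hu (cons_mem_valley.1 h).1,
          indicator_of_notMem (by simpa using hu), mul_zero]
    simp only [heq, indicator_of_mem hy]
    rw [lintegral_const_mul' _ _ (ENNReal.prod_ne_top fun (j : Fin (n + 1)) _ => hφ j (y j)),
      lintegral_indicator measurableSet_Ioi, Fin.prod_univ_succ, Fin.prod_univ_succ]
    simp [mul_right_comm]
  · have heq : ∀ u, (valley (n + 1) (k + 1)).indicator
        (fun t => ∏ j : Fin (n + 1 + 1), φ j (t j)) (Fin.cons u y) = 0 := fun u =>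
      indicator_of_notMem (fun h => hy (cons_mem_valley.1 h).2) _
    simp [heq]

theorem valleyIntegral_zero_le_rev (n : ℕ) (φ : ℕ → ℝ → ENNReal) :
    valleyIntegral n 0 φ ≤ valleyIntegral n n (fun j => φ (n - j)) := by
  have h := volume_measurePreserving_piCongrLeft (fun _ : Fin (n + 1) => ℝ) Fin.revPerm
  unfold valleyIntegral
  rw [← lintegral_indicator (measurableSet_valley _ _),
    ← lintegral_indicator (measurableSet_valley _ _),
    ← h.lintegral_comp_emb (MeasurableEquiv.measurableEmbedding _)]
  refine lintegral_mono fun t => ?_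
  have ht : MeasurableEquiv.piCongrLeft (fun _ : Fin (n + 1) => ℝ) Fin.revPerm t =
      t ∘ Fin.rev := by
    ext i
    have := Equiv.piCongrLeft_apply_apply (fun _ : Fin (n + 1) => ℝ) Fin.revPerm t i.rev
    simpa [MeasurableEquiv.piCongrLeft] using this
  rw [ht]
  by_cases hv : t ∘ Fin.rev ∈ valley n 0
  · rw [indicator_of_mem hv, indicator_of_mem (rev_mem_valley hv)]
    refine (Fintype.prod_equiv Fin.revPerm _ _ fun j => ?_).le
    have : n - (n - (j : ℕ)) = j := by omega
    simp [Fin.val_rev, this]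
  · simp [indicator_of_notMem hv]

theorem lintegral_Ioo_ofReal_deriv {a b : ℝ} (hab : a ≤ b) {f F : ℝ → ℝ}
    (hF : ∀ u ∈ Icc a b, HasDerivAt F (f u) u) (hf : ContinuousOn f (Icc a b))
    (h0 : ∀ u ∈ Icc a b, 0 ≤ f u) :
    ∫⁻ u in Ioo a b, ENNReal.ofReal (f u) = ENNReal.ofReal (F b - F a) := by
  have hint : IntervalIntegrable f volume a b := by
    apply ContinuousOn.intervalIntegrable
    rwa [uIcc_of_le hab]
  rw [← intervalIntegral.integral_eq_sub_of_hasDerivAt (by rwa [uIcc_of_le hab]) hint,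
    intervalIntegral.integral_of_le hab, ofReal_integral_eq_lintegral_ofReal hint.1,
    restrict_Ioo_eq_restrict_Ioc]
  exact (ae_restrict_iff' measurableSet_Ioc).2 (ae_of_all _ fun u hu => h0 u (Ioc_subset_Icc_self hu))

theorem lintegral_inv_mul_log_pow (a : ℕ) {s : ℝ} (hs : s ∈ Ioo (0 : ℝ) 1) :
    ∫⁻ u in Ioo s 1, ENNReal.ofReal (u⁻¹ * (Real.log (1 / u) ^ a / (Nat.factorial a : ℝ))) =
      ENNReal.ofReal (Real.log (1 / s) ^ (a + 1) / (Nat.factorial (a + 1) : ℝ)) := by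
  have hpos : ∀ u ∈ Icc s 1, 0 < u := fun u hu => hs.1.trans_le hu.1
  rw [lintegral_Ioo_ofReal_deriv hs.2.le
    (F := fun u => -((-Real.log u) ^ (a + 1) / (Nat.factorial (a + 1) : ℝ)))]
  · simp
  · intro u hu
    have h := ((((Real.hasDerivAt_log (hpos u hu).ne').neg).pow (a + 1)).div_const
      (Nat.factorial (a + 1) : ℝ)).neg
    refine h.congr_deriv ?_
    have := (hpos u hu).ne'
    have h2 : (Nat.factorial a : ℝ) ≠ 0 := by positivity
    simp [Nat.factorial_succ]
    field_simp
  · refine ContinuousOn.mul (continuousOn_inv₀.mono fun u hu => (hpos u hu).ne') ?_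
    refine ContinuousOn.div_const (ContinuousOn.pow ?_ _) _
    simp only [one_div, Real.log_inv]
    exact (Real.continuousOn_log.mono fun u hu => (hpos u hu).ne').neg
  · intro u hu
    have := hpos u hu
    have : 0 ≤ Real.log (1 / u) := Real.log_nonneg (by rw [le_div_iff₀ this]; linarith [hu.2])
    positivity

theorem lintegral_Ioo_rpow_le {γ s : ℝ} (hγ : 0 < γ) (hs : s ∈ Ioo (0 : ℝ) 1) :
    ∫⁻ u in Ioo s 1, ENNReal.ofReal (u ^ (γ - 1)) ≤ ENNReal.ofReal (1 / γ) := by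
  have hpos : ∀ u ∈ Icc s 1, 0 < u := fun u hu => hs.1.trans_le hu.1
  rw [lintegral_Ioo_ofReal_deriv hs.2.le (F := fun u => u ^ γ / γ)]
  · refine ENNReal.ofReal_le_ofReal ?_
    have : 0 ≤ s ^ γ / γ := div_nonneg (Real.rpow_nonneg hs.1.le _) hγ.le
    simpa using this
  · intro u hu
    refine ((Real.hasDerivAt_rpow_const (Or.inl (hpos u hu).ne')).div_const γ).congr_deriv ?_
    field_simp
  · exact ContinuousOn.rpow_const continuousOn_id fun u hu => Or.inl (hpos u hu).ne'
  · exact fun u hu => Real.rpow_nonneg (hpos u hu).le _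

theorem lintegral_Ioo_rpow_neg_le {γ x : ℝ} (hγ : 1 / 2 < γ) (hx : x ∈ Ioo (0 : ℝ) 1) :
    ∫⁻ u in Ioo x 1, ENNReal.ofReal (u ^ (-γ) * u ^ (-γ)) ≤
      ENNReal.ofReal (x ^ (1 - 2 * γ) / (2 * γ - 1)) := by
  have hpos : ∀ u ∈ Icc x 1, 0 < u := fun u hu => hx.1.trans_le hu.1
  have hne : 2 * γ - 1 ≠ 0 := by linarith
  rw [lintegral_Ioo_ofReal_deriv hx.2.le (F := fun u => -(u ^ (1 - 2 * γ) / (2 * γ - 1)))]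
  · refine ENNReal.ofReal_le_ofReal ?_
    have : 0 < 2 * γ - 1 := by linarith
    simpa using this.le
  · intro u hu
    refine ((Real.hasDerivAt_rpow_const (Or.inl (hpos u hu).ne')).div_const
      (2 * γ - 1)).neg.congr_deriv ?_
    rw [← Real.rpow_add (hpos u hu), show 1 - 2 * γ - 1 = -γ + -γ by ring]
    field_simp
    ring
  · exact ContinuousOn.mul
      (ContinuousOn.rpow_const continuousOn_id fun u hu => Or.inl (hpos u hu).ne')
      (ContinuousOn.rpow_const continuousOn_id fun u hu => Or.inl (hpos u hu).ne')
  · exact fun u hu => by have := hpos u hu; positivity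

theorem setLIntegral_Ioi_eq_Ioo {φ : ℝ → ENNReal} {x s : ℝ}
    (hφ : ∀ u, u ∉ Ioo x 1 → φ u = 0) : ∫⁻ u in Ioi s, φ u = ∫⁻ u in Ioo s 1, φ u := by
  rw [← lintegral_indicator measurableSet_Ioi, ← lintegral_indicator measurableSet_Ioo]
  congr 1 with u
  by_cases hu : u < 1
  · simp [indicator, hu]
  · simp [indicator, hu, hφ u (fun h => hu h.2)]

theorem valleyIntegral_le_of_log_bound {x : ℝ} (hx : 0 < x) {c : ENNReal} (hc : c ≠ ⊤) (k p a : ℕ)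
    (φ : ℕ → ℝ → ENNReal) (hsupp : ∀ j s, s ∉ Ioo x 1 → φ j s = 0)
    (hfin : ∀ j s, φ (j + 1) s ≠ ⊤)
    (h0 : ∀ s ∈ Ioo x 1, ∫⁻ u in Ioi s, φ 0 u ≤
      c * ENNReal.ofReal (Real.log (1 / s) ^ a / (Nat.factorial a : ℝ)))
    (hφ : ∀ j, 0 < j → j < k + 1 → ∀ s ∈ Ioo x 1, φ j s ≤ ENNReal.ofReal s⁻¹) :
    valleyIntegral (p + (k + 1)) (k + 1) φ ≤ valleyIntegral p 0 (fun j s =>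
      if j = 0 then φ (k + 1) s *
        (c * ENNReal.ofReal (Real.log (1 / s) ^ (a + k) / (Nat.factorial (a + k) : ℝ)))
      else φ (j + k + 1) s) := by
  induction k generalizing a φ with
  | zero =>
    refine (valleyIntegral_succ_le _ _ _ hfin).trans (valleyIntegral_mono fun j s => ?_)
    split_ifs with hj
    · by_cases hs : s ∈ Ioo x 1
      · exact mul_le_mul_right (h0 s hs) _
      · simp [hsupp _ s hs]
    · exact le_rfl
  | succ k ih =>
    refine (valleyIntegral_succ_le _ _ _ hfin).trans ?_
    refine (ih (a + 1) _ ?_ ?_ ?_ ?_).trans (valleyIntegral_mono fun j s => ?_)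
    · intro j s hs
      simp [hsupp _ s hs]
    · intro j s
      simpa using hfin (j + 1) s
    · intro s hs
      simp only [if_true]
      rw [setLIntegral_Ioi_eq_Ioo (x := x) (fun u hu => by simp [hsupp _ u hu]),
        ← lintegral_inv_mul_log_pow a ⟨hx.trans hs.1, hs.2⟩, ← lintegral_const_mul' _ _ hc]
      refine setLIntegral_mono' measurableSet_Ioo fun u hu => ?_
      have hu' : u ∈ Ioo x 1 := ⟨hs.1.trans hu.1, hu.2⟩
      rw [ENNReal.ofReal_mul (inv_nonneg.2 (hx.trans hu'.1).le), mul_left_comm]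
      exact mul_le_mul' (hφ 1 one_pos (by omega) u hu') (h0 u hu')
    · intro j hj hjk s hs
      simp only [hj.ne', if_false]
      exact hφ (j + 1) (by omega) (by omega) s hs
    · have e1 : a + 1 + k = a + (k + 1) := by ring
      have e2 : j + (k + 1) + 1 = j + k + 1 + 1 := by ring
      simp [e1, e2]

theorem valleyIntegral_le_lintegral {x : ℝ} (hx : 0 < x) {c : ENNReal} (hc : c ≠ ⊤) (a b : ℕ)
    (φ : ℕ → ℝ → ENNReal) (hsupp : ∀ j s, s ∉ Ioo x 1 → φ j s = 0) (hfin : ∀ j s, φ j s ≠ ⊤)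
    (h_first : ∀ s ∈ Ioo x 1, ∫⁻ u in Ioi s, φ 0 u ≤ c)
    (h_last : ∀ s ∈ Ioo x 1, ∫⁻ u in Ioi s, φ (b + 1 + (a + 1)) u ≤ c)
    (hφ : ∀ j, 0 < j → j < b + 1 + (a + 1) → j ≠ a + 1 → ∀ s ∈ Ioo x 1,
      φ j s ≤ ENNReal.ofReal s⁻¹) :
    valleyIntegral (b + 1 + (a + 1)) (a + 1) φ ≤ ∫⁻ s, φ (a + 1) s *
      (c * ENNReal.ofReal (Real.log (1 / s) ^ a / (Nat.factorial a : ℝ))) *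
      (c * ENNReal.ofReal (Real.log (1 / s) ^ b / (Nat.factorial b : ℝ))) := by
  refine (valleyIntegral_le_of_log_bound hx hc a (b + 1) 0 φ hsupp (fun j => hfin (j + 1))
    (by simpa using h_first)
    (fun j h1 h2 => hφ j h1 (by omega) (by omega))).trans ?_
  refine (valleyIntegral_zero_le_rev _ _).trans ?_
  have h := valleyIntegral_le_of_log_bound hx hc b 0 0 (fun j s =>
      if b + 1 - j = 0 then φ (a + 1) s *
        (c * ENNReal.ofReal (Real.log (1 / s) ^ (0 + a) / (Nat.factorial (0 + a) : ℝ)))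
      else φ (b + 1 - j + a + 1) s) ?_ ?_ ?_ ?_
  · rw [valleyIntegral_zero, zero_add] at h
    simpa using h
  · intro j s hs
    simp [hsupp _ s hs]
  · intro j s
    split_ifs
    · exact ENNReal.mul_ne_top (hfin _ _) (ENNReal.mul_ne_top hc ENNReal.ofReal_ne_top)
    · exact hfin _ _
  · simpa [add_assoc] using h_last
  · intro j h1 h2 s hs
    rw [if_neg (by omega)]
    exact hφ _ (by omega) (by omega) (by omega) s hs

theorem le_of_mem_valley_of_le {n k : ℕ} {t : Fin (n + 1) → ℝ} (ht : t ∈ valley n k)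
    (hk : k ≤ n) {i j : ℕ} (hij : i ≤ j) (hj : j ≤ k) :
    t ⟨j, by omega⟩ ≤ t ⟨i, by omega⟩ := by
  induction j, hij using Nat.le_induction with
  | base => exact le_rfl
  | succ j hij ih => exact ((ht ⟨j, by omega⟩).1 (by simpa using hj)).le.trans (ih (by omega))

theorem le_of_mem_valley_of_ge {n k : ℕ} {t : Fin (n + 1) → ℝ} (ht : t ∈ valley n k)
    {i j : ℕ} (hki : k ≤ i) (hij : i ≤ j) (hj : j ≤ n) :
    t ⟨i, by omega⟩ ≤ t ⟨j, by omega⟩ := by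
  induction j, hij using Nat.le_induction with
  | base => exact le_rfl
  | succ j hij ih => exact (ih (by omega)).trans ((ht ⟨j, by omega⟩).2 (by simp; omega)).le

theorem mem_Ioo_of_mem_valley {n k : ℕ} {t : Fin (n + 1) → ℝ} (ht : t ∈ valley n k)
    (hk : k ≤ n) {x y : ℝ} (hx : x < t ⟨k, by omega⟩) (h0 : t 0 < y)
    (hn : t ⟨n, n.lt_succ_self⟩ < y) (j : Fin (n + 1)) : t j ∈ Ioo x y := by
  rcases le_total (j : ℕ) k with h | h
  · exact ⟨hx.trans_le (le_of_mem_valley_of_le ht hk h le_rfl),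
      (le_of_mem_valley_of_le ht hk (Nat.zero_le _) h).trans_lt h0⟩
  · exact ⟨hx.trans_le (le_of_mem_valley_of_ge ht le_rfl h (by omega)),
      (le_of_mem_valley_of_ge ht h (by omega : (j : ℕ) ≤ n) le_rfl).trans_lt hn⟩

/-- The factor of the skeleton integrand that depends on the birth time of index `j`. -/
noncomputable def skeletonWeight (γ : ℝ) (m k j : ℕ) (s : ℝ) : ℝ :=
  if j = 0 ∨ j = m then s ^ (γ - 1) else if j = k then s ^ (-γ) * s ^ (-γ) else s⁻¹

theorem prod_skeletonWeight (γ : ℝ) {m k : ℕ} (hk : 0 < k) (hkm : k < m)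
    (t : Fin (m + 1) → ℝ) :
    ∏ j : Fin (m + 1), skeletonWeight γ m k j (t j) =
      t 0 ^ (γ - 1) * t ⟨k, by omega⟩ ^ (-γ) * t ⟨k, by omega⟩ ^ (-γ) *
        t ⟨m, m.lt_succ_self⟩ ^ (γ - 1) *
        ∏ j : Fin (m + 1), (if 0 < (j : ℕ) ∧ (j : ℕ) < m ∧ (j : ℕ) ≠ k then (t j)⁻¹ else 1) := by
  have h : ∀ j : Fin (m + 1), skeletonWeight γ m k j (t j) =
      (if j = 0 then t j ^ (γ - 1) else 1) *
      (if j = ⟨k, by omega⟩ then t j ^ (-γ) * t j ^ (-γ) else 1) *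
      (if j = ⟨m, m.lt_succ_self⟩ then t j ^ (γ - 1) else 1) *
      (if 0 < (j : ℕ) ∧ (j : ℕ) < m ∧ (j : ℕ) ≠ k then (t j)⁻¹ else 1) := by
    intro j
    have hj := j.2
    simp only [skeletonWeight, Fin.ext_iff, Fin.val_zero]
    rcases Nat.eq_zero_or_pos (j : ℕ) with h0 | h0
    · simp [h0, hk.ne, (hk.trans hkm).ne]
    rcases eq_or_ne (j : ℕ) k with h1 | h1
    · simp [h1, hk.ne', hkm.ne]
    rcases eq_or_ne (j : ℕ) m with h2 | h2
    · simp [h2, hkm.ne', (hk.trans hkm).ne']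
    · simp [h0, h0.ne', h1, h2, (by omega : (j : ℕ) < m)]
  simp only [h, Finset.prod_mul_distrib, Finset.prod_ite_eq',
    Finset.mem_univ, if_true]
  ring

theorem skeletonWeight_nonneg (γ : ℝ) (m k j : ℕ) {s : ℝ} (hs : 0 ≤ s) :
    0 ≤ skeletonWeight γ m k j s := by
  unfold skeletonWeight
  split_ifs <;> positivity

theorem valleyIntegral_skeletonWeight_le {γ x : ℝ} (hγ : 1 / 2 < γ) (hx : x ∈ Ioo (0 : ℝ) 1)
    (a b : ℕ) :
    valleyIntegral (b + 1 + (a + 1)) (a + 1) (fun j => (Ioo x 1).indicator fun s =>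
        ENNReal.ofReal (skeletonWeight γ (b + 1 + (a + 1)) (a + 1) j s)) ≤
      ENNReal.ofReal (x ^ (1 - 2 * γ) * Real.log (1 / x) ^ (a + b) /
        (γ ^ 2 * (2 * γ - 1) * ((Nat.factorial a : ℝ) * Nat.factorial b))) := by
  have hγ0 : 0 < γ := by linarith
  have hend : ∀ j, j = 0 ∨ j = b + 1 + (a + 1) → ∀ s ∈ Ioo x 1, ∫⁻ u in Ioi s,
      (Ioo x 1).indicator (fun s =>
        ENNReal.ofReal (skeletonWeight γ (b + 1 + (a + 1)) (a + 1) j s)) u ≤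
      ENNReal.ofReal (1 / γ) := by
    intro j hj s hs
    rw [setLIntegral_Ioi_eq_Ioo (fun u hu => indicator_of_notMem hu _)]
    refine le_trans (lintegral_mono fun u => indicator_le_self _ _ u) ?_
    simp only [skeletonWeight, hj, if_true]
    exact lintegral_Ioo_rpow_le hγ0 ⟨hx.1.trans hs.1, hs.2⟩
  refine (valleyIntegral_le_lintegral hx.1 ENNReal.ofReal_ne_top a b
    (fun j => (Ioo x 1).indicator fun s =>
      ENNReal.ofReal (skeletonWeight γ (b + 1 + (a + 1)) (a + 1) j s))
    (fun j s hs => indicator_of_notMem hs _) (fun j s => ?_) (hend 0 (Or.inl rfl))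
    (hend (b + 1 + (a + 1)) (Or.inr rfl)) (fun j h1 h2 h3 s hs => ?_)).trans ?_
  · rw [indicator_apply]
    split_ifs <;> simp
  · rw [indicator_of_mem hs]
    simp [skeletonWeight, h1.ne', h2.ne, h3]
  set K : ℝ := Real.log (1 / x) ^ (a + b) / (γ ^ 2 * ((Nat.factorial a : ℝ) * Nat.factorial b))
    with hK
  have hlogx : 0 ≤ Real.log (1 / x) :=
    Real.log_nonneg (by rw [le_div_iff₀ hx.1]; linarith [hx.2])
  have hK0 : 0 ≤ K := by positivity
  calc _ ≤ ∫⁻ s, (Ioo x 1).indicator (fun s =>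
        ENNReal.ofReal K * ENNReal.ofReal (s ^ (-γ) * s ^ (-γ))) s := by
        refine lintegral_mono fun s => ?_
        by_cases hs : s ∈ Ioo x 1
        · have hs0 : 0 < s := hx.1.trans hs.1
          have hlog : 0 ≤ Real.log (1 / s) :=
            Real.log_nonneg (by rw [le_div_iff₀ hs0]; linarith [hs.2])
          have hle : Real.log (1 / s) ≤ Real.log (1 / x) :=
            Real.log_le_log (by positivity) (one_div_le_one_div_of_le hx.1 hs.1.le)
          simp only [indicator_of_mem hs]
          have hw : skeletonWeight γ (b + 1 + (a + 1)) (a + 1) (a + 1) s =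
              s ^ (-γ) * s ^ (-γ) := by
            simp [skeletonWeight]
          have hγi : 0 ≤ 1 / γ := by positivity
          rw [hw, ← ENNReal.ofReal_mul hγi, ← ENNReal.ofReal_mul hγi,
            ← ENNReal.ofReal_mul (by positivity), ← ENNReal.ofReal_mul (by positivity),
            ← ENNReal.ofReal_mul hK0]
          refine ENNReal.ofReal_le_ofReal ?_
          calc _ = Real.log (1 / s) ^ (a + b) /
                (γ ^ 2 * ((Nat.factorial a : ℝ) * Nat.factorial b)) *
                (s ^ (-γ) * s ^ (-γ)) := by
                rw [pow_add]
                field_simp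
            _ ≤ _ := by
                rw [hK]
                gcongr
        · simp [indicator_of_notMem hs]
    _ = ENNReal.ofReal K * ∫⁻ s in Ioo x 1, ENNReal.ofReal (s ^ (-γ) * s ^ (-γ)) := by
        rw [lintegral_indicator measurableSet_Ioo, lintegral_const_mul' _ _ ENNReal.ofReal_ne_top]
    _ ≤ ENNReal.ofReal K * ENNReal.ofReal (x ^ (1 - 2 * γ) / (2 * γ - 1)) :=
        mul_le_mul_right (lintegral_Ioo_rpow_neg_le hγ hx) _
    _ = _ := by
        rw [← ENNReal.ofReal_mul hK0, hK]
        congr 1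
        have : 2 * γ - 1 ≠ 0 := by linarith
        field_simp

end Valley

/-- Lemma A.4: for `γ ∈ (1/2,1)`, integers `m ≥ 2`, `1 ≤ k ≤ m-1`, and `x ∈ (0,1)`, the
integral over the region of birth times `t_0, …, t_m` that decrease from `t_0 < 1` down to a
minimum `t_k > x` and then increase up to `t_m < 1`, of the integrand
`t_0^(γ-1) (∏_{j=1}^{k-1} t_j^(-1)) t_k^(-γ) · t_k^(-γ) (∏_{j=k+1}^{m-1} t_j^(-1)) t_m^(γ-1)`,
is at most `(m-2 choose k-1) x^(1-2γ) (log(1/x))^(m-2) / (γ² (2γ-1) (m-2)!)`. -/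
theorem skeleton_integral_bound (γ x : ℝ) (hγ : γ ∈ Set.Ioo (1 / 2 : ℝ) 1)
    (hx : x ∈ Set.Ioo (0 : ℝ) 1) (m k : ℕ) (hm : 2 ≤ m) (hk1 : 1 ≤ k) (hkm : k ≤ m - 1) :
    ∫⁻ t in {t : Fin (m + 1) → ℝ |
        x < t ⟨k, by omega⟩ ∧ t 0 < 1 ∧ t ⟨m, by omega⟩ < 1 ∧
        ∀ i : Fin m, ((i : ℕ) < k → t i.succ < t i.castSucc) ∧
          (k ≤ (i : ℕ) → t i.castSucc < t i.succ)},
      ENNReal.ofReal (t 0 ^ (γ - 1) * (t ⟨k, by omega⟩) ^ (-γ) * (t ⟨k, by omega⟩) ^ (-γ) *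
        (t ⟨m, by omega⟩) ^ (γ - 1) *
        ∏ j : Fin (m + 1), (if 0 < (j : ℕ) ∧ (j : ℕ) < m ∧ (j : ℕ) ≠ k then (t j)⁻¹ else 1)) ≤
    ENNReal.ofReal ((Nat.choose (m - 2) (k - 1) : ℝ) * x ^ (1 - 2 * γ) *
      Real.log (1 / x) ^ (m - 2) / (γ ^ 2 * (2 * γ - 1) * (Nat.factorial (m - 2) : ℝ))) := by
  obtain ⟨a, rfl⟩ : ∃ a, k = a + 1 := ⟨k - 1, by omega⟩
  obtain ⟨b, rfl⟩ : ∃ b, m = b + 1 + (a + 1) := ⟨m - a - 2, by omega⟩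
  have hbound := valleyIntegral_skeletonWeight_le hγ.1 hx a b
  have hmeas : MeasurableSet {t : Fin (b + 1 + (a + 1) + 1) → ℝ |
      x < t ⟨a + 1, by omega⟩ ∧ t 0 < 1 ∧ t ⟨b + 1 + (a + 1), by omega⟩ < 1 ∧
        t ∈ valley (b + 1 + (a + 1)) (a + 1)} :=
    (measurableSet_lt measurable_const (measurable_pi_apply _)).inter
      ((measurableSet_lt (measurable_pi_apply _) measurable_const).inter
        ((measurableSet_lt (measurable_pi_apply _) measurable_const).inter
          (measurableSet_valley _ _)))
  refine (setLIntegral_mono' hmeas fun t ht => ?_).trans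
    ((lintegral_mono_set fun t ht => ht.2.2.2).trans (hbound.trans_eq ?_))
  · have hIoo := mem_Ioo_of_mem_valley ht.2.2.2 (by omega) ht.1 ht.2.1 ht.2.2.1
    simp only [Set.indicator_of_mem (hIoo _)]
    rw [← ENNReal.ofReal_prod_of_nonneg fun j _ =>
        skeletonWeight_nonneg _ _ _ _ (hx.1.trans (hIoo j).1).le,
      prod_skeletonWeight γ (by omega) (by omega)]
  · have h1 : b + 1 + (a + 1) - 2 = a + b := by omega
    have h2 : ((a + b).choose a : ℝ) * ((Nat.factorial a : ℝ) * Nat.factorial b) =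
        Nat.factorial (a + b) := by
      rw [← Nat.add_choose_mul_factorial_mul_factorial a b, Nat.choose_symm_add]
      push_cast
      ring
    have h3 : ((a + b).choose a : ℝ) ≠ 0 := by
      exact_mod_cast (Nat.choose_pos (Nat.le_add_right a b)).ne'
    rw [h1, Nat.add_sub_cancel, ← h2]
    congr 1
    have h4 : 2 * γ - 1 ≠ 0 := by linarith [hγ.1]
    have h5 : γ ≠ 0 := by linarith [hγ.1]
    field_simp
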